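/- arXiv:2510.20294 — 2 statements merged into one kernel-verified Lean document; each statement's English description precedes it below -/
import Mathlib

section
/- Let G be a finite d-regular simple graph with d ≥ 1, let p be a real number with 0 ≤ p ≤ 1, and let W be any independent set of vertices of G. Then t_e(G,p) ≤ (1 − p^d)^{|W|}. -/
open Classical in
/-- The edge-fault (EF) tolerance `t_e(G, p)`: the probability that `G` remains
connected when each edge is deleted independently with probability `p`. -/
noncomputable def efTolerance {V : Type*} [Fintype V] (G : SimpleGraph V) (p : ℝ) : ℝ :=
  ∑ F ∈ G.edgeFinset.powerset,
    if (G.deleteEdges (↑F : Set (Sym2 V))).Connected then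
      p ^ F.card * (1 - p) ^ (G.edgeFinset.card - F.card)
    else 0

open Classical in
theorem ef_aux {V α : Type*} (S : V → Finset α) (d : ℕ) (p : ℝ) (W : Finset V) :
    ∀ E : Finset α, (∀ w ∈ W, S w ⊆ E ∧ (S w).card = d) →
    (∀ u ∈ W, ∀ v ∈ W, u ≠ v → Disjoint (S u) (S v)) →
    ∑ F ∈ E.powerset, (if ∀ w ∈ W, ¬ S w ⊆ F then
      p ^ F.card * (1 - p) ^ (E.card - F.card) else 0) = (1 - p ^ d) ^ W.card := by
  induction W using Finset.induction_on with
  | empty =>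
    intro E _ _
    simp [Finset.sum_pow_mul_eq_add_pow]
  | insert w W hw ih =>
    intro E hS hD
    have hSw := hS w (Finset.mem_insert_self _ _)
    have hdis : ∀ v ∈ W, Disjoint (S v) (S w) := fun v hv =>
      hD v (Finset.mem_insert_of_mem hv) w (Finset.mem_insert_self _ _)
        (fun h => hw (h ▸ hv))
    have hD' : ∀ u ∈ W, ∀ v ∈ W, u ≠ v → Disjoint (S u) (S v) := fun u hu v hv =>
      hD u (Finset.mem_insert_of_mem hu) v (Finset.mem_insert_of_mem hv)
    have h1 := ih E (fun v hv => hS v (Finset.mem_insert_of_mem hv)) hD'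
    have h2 := ih (E \ S w) (fun v hv =>
      ⟨Finset.subset_sdiff.2 ⟨(hS v (Finset.mem_insert_of_mem hv)).1, hdis v hv⟩,
        (hS v (Finset.mem_insert_of_mem hv)).2⟩) hD'
    have h3 : ∑ F ∈ E.powerset with S w ⊆ F, (if ∀ v ∈ W, ¬ S v ⊆ F then
        p ^ F.card * (1 - p) ^ (E.card - F.card) else 0) = p ^ d * (1 - p ^ d) ^ W.card := by
      rw [← h2, Finset.mul_sum]
      refine Finset.sum_bij' (fun F _ => F \ S w) (fun F _ => F ∪ S w) ?_ ?_ ?_ ?_ ?_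
      · intro F hF
        simp only [Finset.mem_filter, Finset.mem_powerset] at hF ⊢
        exact Finset.sdiff_subset_sdiff hF.1 le_rfl
      · intro F hF
        simp only [Finset.mem_filter, Finset.mem_powerset] at hF ⊢
        exact ⟨Finset.union_subset (hF.trans Finset.sdiff_subset) hSw.1,
          Finset.subset_union_right⟩
      · intro F hF
        simp only [Finset.mem_filter, Finset.mem_powerset] at hF
        exact Finset.sdiff_union_of_subset hF.2
      · intro F hF
        simp only [Finset.mem_powerset] at hF
        exact Finset.union_sdiff_cancel_right (Finset.subset_sdiff.1 hF).2
      · intro F hF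
        simp only [Finset.mem_filter, Finset.mem_powerset] at hF
        have hc : (∀ v ∈ W, ¬ S v ⊆ F) ↔ (∀ v ∈ W, ¬ S v ⊆ F \ S w) := by
          refine forall₂_congr fun v hv => ?_
          rw [Finset.subset_sdiff]
          simp [hdis v hv]
        have c1 := Finset.card_sdiff_add_card_eq_card hF.2
        have c2 := Finset.card_sdiff_add_card_eq_card hSw.1
        rw [hSw.2] at c1 c2
        simp only [hc]
        split_ifs
        · rw [← c1, ← c2, Nat.add_sub_add_right, pow_add]
          ring
        · simp
    rw [Finset.sum_filter] at h3
    rw [Finset.card_insert_of_notMem hw]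
    have h4 : (1 - p ^ d) ^ (W.card + 1) = (1 - p ^ d) ^ W.card - p ^ d * (1 - p ^ d) ^ W.card := by
      ring
    rw [h4, ← h3, ← h1, ← Finset.sum_sub_distrib]
    refine Finset.sum_congr rfl fun F _ => ?_
    simp only [Finset.forall_mem_insert]
    by_cases a : S w ⊆ F <;> simp [a]

/-- for a finite `d`-regular simple graph `G` with `d ≥ 1`, a real
`p ∈ [0,1]`, and any independent set `W` of vertices of `G`,
`t_e(G, p) ≤ (1 - p ^ d) ^ |W|`. -/
theorem efTolerance_le_of_indepSet {V : Type*} [Fintype V] (G : SimpleGraph V)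
    [DecidableRel G.Adj] (d : ℕ) (hd : 1 ≤ d) (hreg : G.IsRegularOfDegree d)
    (p : ℝ) (hp0 : 0 ≤ p) (hp1 : p ≤ 1)
    (W : Finset V) (hW : ∀ u ∈ W, ∀ v ∈ W, ¬ G.Adj u v) :
    efTolerance G p ≤ (1 - p ^ d) ^ W.card := by
  classical
  have hp1' : 0 ≤ 1 - p := by linarith
  rw [← ef_aux (fun w => G.incidenceFinset w) d p W G.edgeFinset]
  · unfold efTolerance
    have key : ∀ F : Finset (Sym2 V), (G.deleteEdges (↑F : Set (Sym2 V))).Connected →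
        ∀ w ∈ W, ¬ G.incidenceFinset w ⊆ F := by
      intro F hF w _ hs
      have hdeg : 0 < G.degree w := by rw [hreg w]; omega
      obtain ⟨u, hu⟩ := (G.degree_pos_iff_exists_adj w).1 hdeg
      have : Nontrivial V := ⟨w, u, hu.ne⟩
      obtain ⟨x, hx⟩ := hF.preconnected.exists_adj_of_nontrivial w
      rw [SimpleGraph.deleteEdges_adj] at hx
      apply hx.2
      apply hs
      rw [SimpleGraph.mem_incidenceFinset]
      exact (G.mem_incidenceSet w x).2 hx.1
    have e : ∀ (i j : Fintype G.edgeSet),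
        @SimpleGraph.edgeFinset V G i = @SimpleGraph.edgeFinset V G j := by
      intro i j
      congr!
    rw [e _ (Fintype.ofFinite _)]
    conv_rhs => rw [e _ (Fintype.ofFinite _)]
    apply Finset.sum_le_sum
    intro F _
    split_ifs with a b b
    · exact le_rfl
    · exact absurd (key F a) b
    · positivity
    · exact le_rfl
  · intro w _
    refine ⟨fun e he => ?_, by rw [SimpleGraph.card_incidenceFinset_eq_degree]; exact hreg w⟩
    rw [SimpleGraph.mem_incidenceFinset] at he
    exact SimpleGraph.mem_edgeFinset.2 he.1
  · intro u hu v hv huv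
    rw [Finset.disjoint_left]
    intro e he he'
    rw [SimpleGraph.mem_incidenceFinset] at he he'
    have := (Sym2.mem_and_mem_iff huv).1 ⟨he.2, he'.2⟩
    subst this
    exact hW u hu v hv he.1
end

section
/- Let (G_k)_{k≥1} be a sequence of finite simple graphs where G_k is d_k-regular with d_k ≥ 1 and d_k → ∞ as k → ∞. Suppose there are real constants c > 0 and α > 1 such that i(G_k) / (c · α^{d_k}) → 1 as k → ∞, where i(G_k) is the independence number of G_k. If p is a real number with 1/α < p ≤ 1, then t_e(G_k, p) → 0 as k → ∞. -/
/-- The independence number `i(G)`: the maximum cardinality of a set of pairwise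
non-adjacent vertices of `G`. -/
noncomputable def indepNum {V : Type*} [Fintype V] (G : SimpleGraph V) : ℕ :=
  sSup {n | ∃ W : Finset V, (∀ u ∈ W, ∀ v ∈ W, ¬ G.Adj u v) ∧ W.card = n}

open Classical in
lemma ef_sum_superset {β : Type*} (E U : Finset β) (hU : U ⊆ E) (p : ℝ) :
    ∑ F ∈ E.powerset, (if U ⊆ F then p ^ F.card * (1 - p) ^ (E.card - F.card) else 0)
      = p ^ U.card := by
  have h := Finset.prod_add (fun _ : β => p) (fun i => if i ∈ U then 0 else 1 - p) E
  have h1 : ∏ i ∈ E, (p + if i ∈ U then 0 else 1 - p) = p ^ U.card := by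
    have : ∀ i ∈ E, (p + if i ∈ U then 0 else 1 - p) = if i ∈ U then p else 1 := by
      intro i _
      split_ifs <;> ring
    rw [Finset.prod_congr rfl this, Finset.prod_ite_mem, Finset.inter_eq_right.2 hU,
      Finset.prod_const]
  rw [← h1, h]
  refine Finset.sum_congr rfl fun F hF => ?_
  have hF := Finset.mem_powerset.1 hF
  rw [Finset.prod_const]
  split_ifs with hUF
  · congr 1
    rw [← Finset.card_sdiff_of_subset hF, ← Finset.prod_const]
    refine Finset.prod_congr rfl fun i hi => ?_
    rw [if_neg]
    exact fun hiU => (Finset.mem_sdiff.1 hi).2 (hUF hiU)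
  · obtain ⟨i, hiU, hiF⟩ := Finset.not_subset.1 hUF
    rw [Finset.prod_eq_zero (i := i), mul_zero]
    · exact Finset.mem_sdiff.2 ⟨hU hiU, hiF⟩
    · simp [hiU]

open Classical in
lemma ef_sum_avoid {β ι : Type*} (E : Finset β) (W : Finset ι) (I : ι → Finset β)
    (hI : ∀ w ∈ W, I w ⊆ E) (n : ℕ) (hn : ∀ w ∈ W, (I w).card = n)
    (hdis : (W : Set ι).PairwiseDisjoint I) (p : ℝ) :
    ∑ F ∈ E.powerset, (if ∀ w ∈ W, ¬ I w ⊆ F then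
      p ^ F.card * (1 - p) ^ (E.card - F.card) else 0) = (1 - p ^ n) ^ W.card := by
  have h1 : ∀ F ∈ E.powerset, (if ∀ w ∈ W, ¬ I w ⊆ F then
      p ^ F.card * (1 - p) ^ (E.card - F.card) else 0) =
      ∑ T ∈ W.powerset, (-1) ^ T.card * (if T.biUnion I ⊆ F then
        p ^ F.card * (1 - p) ^ (E.card - F.card) else 0) := by
    intro F _
    have h2 := Finset.prod_add (fun w => -(if I w ⊆ F then (1:ℝ) else 0)) (fun _ => 1) W
    have h3 : ∏ w ∈ W, (-(if I w ⊆ F then (1:ℝ) else 0) + 1)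
        = if ∀ w ∈ W, ¬ I w ⊆ F then 1 else 0 := by
      split_ifs with h
      · exact Finset.prod_eq_one fun w hw => by simp [h w hw]
      · push Not at h
        obtain ⟨w, hw, hwF⟩ := h
        exact Finset.prod_eq_zero hw (by simp [hwF])
    rw [h3] at h2
    have h4 : ∀ T : Finset ι, ∏ w ∈ T, (-(if I w ⊆ F then (1:ℝ) else 0))
        = (-1) ^ T.card * if T.biUnion I ⊆ F then 1 else 0 := by
      intro T
      rw [Finset.prod_neg]
      congr 1
      rw [Finset.prod_ite_zero, Finset.prod_const_one]
      simp only [Finset.biUnion_subset]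
    simp only [h4, Finset.prod_const_one, mul_one] at h2
    calc _ = (if ∀ w ∈ W, ¬ I w ⊆ F then (1:ℝ) else 0) *
          (p ^ F.card * (1 - p) ^ (E.card - F.card)) := by
            split_ifs <;> simp
      _ = _ := by
        rw [h2, Finset.sum_mul]
        refine Finset.sum_congr rfl fun T _ => ?_
        split_ifs <;> simp
  rw [Finset.sum_congr rfl h1, Finset.sum_comm]
  have h5 := Finset.prod_add (fun _ : ι => - p ^ n) (fun _ => 1) W
  rw [Finset.prod_const] at h5
  rw [show 1 - p ^ n = - p ^ n + 1 by ring, h5]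
  refine Finset.sum_congr rfl fun T hT => ?_
  have hT := Finset.mem_powerset.1 hT
  rw [← Finset.mul_sum, ef_sum_superset]
  · rw [Finset.card_biUnion fun x hx y hy hxy => hdis (hT hx) (hT hy) hxy,
      Finset.sum_congr rfl fun w hw => hn w (hT hw)]
    simp only [Finset.prod_const, Finset.sum_const, smul_eq_mul, one_pow, mul_one]
    rw [neg_pow (p ^ n), ← pow_mul, mul_comm n]
  · exact Finset.biUnion_subset.2 fun w hw => hI w (hT hw)

open Classical in
lemma efTolerance_le {V : Type*} [Fintype V] (G : SimpleGraph V) [DecidableRel G.Adj] (d : ℕ)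
    (hd : 1 ≤ d) (hreg : G.IsRegularOfDegree d) (p : ℝ) (h0 : 0 ≤ p) (h1 : p ≤ 1)
    (W : Finset V) (hW : ∀ u ∈ W, ∀ v ∈ W, ¬ G.Adj u v) :
    efTolerance G p ≤ (1 - p ^ d) ^ W.card := by
  have key := ef_sum_avoid G.edgeFinset W (fun w => G.edgeFinset.filter (w ∈ ·))
    (fun w _ => Finset.filter_subset _ _) d
    (by
      intro w _
      rw [← SimpleGraph.incidenceFinset_eq_filter, SimpleGraph.card_incidenceFinset_eq_degree]
      convert hreg w)
    (by
      intro u hu v hv huv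
      refine Finset.disjoint_left.2 fun e he he' => ?_
      simp only [Finset.mem_filter, SimpleGraph.mem_edgeFinset] at he he'
      have := (Sym2.mem_and_mem_iff huv).1 ⟨he.2, he'.2⟩
      subst this
      exact hW u hu v hv he.1) p
  have heq : efTolerance G p = ∑ F ∈ G.edgeFinset.powerset,
      if (G.deleteEdges (↑F : Set (Sym2 V))).Connected then
        p ^ F.card * (1 - p) ^ (G.edgeFinset.card - F.card) else 0 := by
    unfold efTolerance
    congr!
  rw [← key, heq]
  have hnn : ∀ F : Finset (Sym2 V),
      0 ≤ p ^ F.card * (1 - p) ^ (G.edgeFinset.card - F.card) := fun F =>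
    mul_nonneg (pow_nonneg h0 _) (pow_nonneg (by linarith) _)
  have hstep : ∀ F : Finset (Sym2 V), (G.deleteEdges (↑F : Set (Sym2 V))).Connected →
      ∀ w ∈ W, ¬ (G.edgeFinset.filter (w ∈ ·)) ⊆ F := by
    intro F hc w _ hsub
    have hdeg : 0 < G.degree w := by rw [hreg w]; omega
    obtain ⟨x, hx⟩ := (G.degree_pos_iff_exists_adj w).1 hdeg
    have : Nontrivial V := ⟨w, x, hx.ne⟩
    obtain ⟨y, hy⟩ := hc.preconnected.exists_adj_of_nontrivial w
    rw [SimpleGraph.deleteEdges_adj] at hy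
    exact hy.2 (hsub (by simp [hy.1]))
  refine Finset.sum_le_sum fun F _ => ?_
  have := hnn F
  have := hstep F
  split_ifs with ha hb <;> first | exact le_refl _ | assumption | (exfalso; tauto)

lemma exists_indepNum {V : Type*} [Fintype V] (G : SimpleGraph V) :
    ∃ W : Finset V, (∀ u ∈ W, ∀ v ∈ W, ¬ G.Adj u v) ∧ W.card = indepNum G := by
  have := Nat.sSup_mem
    (s := {n | ∃ W : Finset V, (∀ u ∈ W, ∀ v ∈ W, ¬ G.Adj u v) ∧ W.card = n})
    ⟨0, ∅, by simp⟩ ⟨Fintype.card V, by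
      rintro n ⟨W, _, rfl⟩
      exact W.card_le_univ⟩
  exact this

/-- let `G k` be a `d k`-regular finite simple graph with `d k ≥ 1` and
`d k → ∞`. If `i(G k) / (c * α ^ d k) → 1` for constants `c > 0`, `α > 1`, and
`1/α < p ≤ 1`, then `t_e(G k, p) → 0` as `k → ∞`. -/
theorem tendsto_efTolerance_zero {V : ℕ → Type*} [∀ k, Fintype (V k)]
    (G : ∀ k, SimpleGraph (V k)) [∀ k, DecidableRel fun u v => (G k).Adj u v]
    (d : ℕ → ℕ) (hd1 : ∀ k, 1 ≤ d k)
    (hreg : ∀ k, (G k).IsRegularOfDegree (d k))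
    (hd : Filter.Tendsto d Filter.atTop Filter.atTop)
    (c α : ℝ) (hc : 0 < c) (hα : 1 < α)
    (hi : Filter.Tendsto (fun k => (indepNum (G k) : ℝ) / (c * α ^ d k))
      Filter.atTop (nhds 1))
    (p : ℝ) (hp1 : 1 / α < p) (hp2 : p ≤ 1) :
    Filter.Tendsto (fun k => efTolerance (G k) p) Filter.atTop (nhds 0) := by
  have hp0 : 0 < p := lt_trans (by positivity) hp1
  have hαp : 1 < α * p := by
    rw [div_lt_iff₀ (by linarith)] at hp1
    linarith
  have hle : ∀ k, efTolerance (G k) p ≤ Real.exp (-((indepNum (G k) : ℝ) * p ^ d k)) := by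
    intro k
    obtain ⟨W, hW, hcard⟩ := exists_indepNum (G k)
    refine (efTolerance_le (G k) (d k) (hd1 k) (hreg k) p hp0.le hp2 W hW).trans ?_
    have h1 : 0 ≤ 1 - p ^ d k := sub_nonneg.2 (pow_le_one₀ hp0.le hp2)
    have h2 : 1 - p ^ d k ≤ Real.exp (-(p ^ d k)) := by
      have := Real.add_one_le_exp (-(p ^ d k))
      linarith
    refine (pow_le_pow_left₀ h1 h2 _).trans (le_of_eq ?_)
    rw [← Real.exp_nat_mul, hcard, mul_neg]
  have hnn : ∀ k, 0 ≤ efTolerance (G k) p := by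
    intro k
    refine Finset.sum_nonneg fun F _ => ?_
    split_ifs
    · exact mul_nonneg (pow_nonneg hp0.le _) (pow_nonneg (by linarith) _)
    · exact le_rfl
  refine squeeze_zero hnn hle ?_
  refine Real.tendsto_exp_neg_atTop_nhds_zero.comp ?_
  have h3 : Filter.Tendsto (fun k => c * (α * p) ^ d k) Filter.atTop Filter.atTop :=
    ((tendsto_pow_atTop_atTop_of_one_lt hαp).comp hd).const_mul_atTop hc
  refine (Filter.Tendsto.pos_mul_atTop one_pos hi h3).congr fun k => ?_
  have : α ^ d k ≠ 0 := by positivity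
  rw [mul_pow]
  field_simp
end
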